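/- arXiv:2411.08004 — 2 statements merged into one kernel-verified Lean document; each statement's English description precedes it below -/
import Mathlib

section
/- Let R be a semiprime left Goldie ring and let R' be a subring of R containing an essential left ideal of R. Then R' is a semiprime left Goldie ring. -/
/-- A two-sided ideal `I` of a ring is nilpotent if for some `n ≥ 1` every product of
`n` elements of `I` vanishes. -/
def TwoSidedIdeal.IsNilpotentIdeal {R : Type*} [Ring R] (I : TwoSidedIdeal R) : Prop :=
  ∃ n : ℕ, 0 < n ∧ ∀ f : Fin n → R, (∀ i, f i ∈ I) → (List.ofFn f).prod = 0

/-- A ring is semiprime if it has no nonzero nilpotent two-sided ideal. -/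
def IsSemiprimeRing' (R : Type*) [Ring R] : Prop :=
  ∀ I : TwoSidedIdeal R, I.IsNilpotentIdeal → I = ⊥

/-- A ring has finite left uniform dimension if it contains no infinite direct sum of
nonzero left ideals. -/
def HasFiniteLeftUniformDimension (R : Type*) [Ring R] : Prop :=
  ¬ ∃ f : ℕ → Ideal R, (∀ n, f n ≠ ⊥) ∧ iSupIndep f

/-- The left annihilator of a subset `S` of a ring. -/
def leftAnnihilator (R : Type*) [Ring R] (S : Set R) : Set R :=
  {r : R | ∀ s ∈ S, r * s = 0}

/-- The ascending chain condition on left annihilators. -/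
def ACCLeftAnnihilators (R : Type*) [Ring R] : Prop :=
  ∀ f : ℕ → Set R, (∀ n, ∃ S : Set R, f n = leftAnnihilator R S) → Monotone f →
    ∃ N, ∀ n, N ≤ n → f n = f N

/-- A ring is a left Goldie ring if it has finite left uniform dimension and satisfies
the a.c.c. on left annihilators. -/
def IsLeftGoldieRing (R : Type*) [Ring R] : Prop :=
  HasFiniteLeftUniformDimension R ∧ ACCLeftAnnihilators R

/-- A left ideal is essential if it meets every nonzero left ideal nontrivially. -/
def IsEssentialLeftIdeal {R : Type*} [Ring R] (I : Ideal R) : Prop :=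
  ∀ J : Ideal R, J ≠ ⊥ → I ⊓ J ≠ ⊥

/-- A ring endomorphism has large image if its image contains an essential left ideal. -/
def HasLargeImage {R : Type*} [Ring R] (σ : R →+* R) : Prop :=
  ∃ I : Ideal R, IsEssentialLeftIdeal I ∧ (I : Set R) ⊆ Set.range σ

/-- The left uniform dimension of a module, with values in `ℕ∞`: the supremum of the
numbers `k` such that `M` contains a direct sum of `k` nonzero submodules. -/
noncomputable def udim (R : Type*) [Ring R] (M : Type*) [AddCommGroup M] [Module R M] : ℕ∞ :=
  sSup {n : ℕ∞ | ∃ (k : ℕ) (f : Fin k → Submodule R M),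
    n = (k : ℕ∞) ∧ (∀ i, f i ≠ ⊥) ∧ iSupIndep f}

/-- `DevLE α P` means that the deviation of the poset `P` is at most the ordinal `α`:
for every descending chain, all but finitely many of its factor intervals either are
trivial or have deviation at most some ordinal `β < α`. -/
def DevLE (α : Ordinal.{v}) (P : Type u) [Preorder P] : Prop :=
  ∀ f : ℕ → P, (∀ n, f (n + 1) ≤ f n) →
    ∃ N : ℕ, ∀ n, N ≤ n →
      (∀ x y : Set.Icc (f (n + 1)) (f n), x ≤ y → y ≤ x) ∨
      ∃ (β : Ordinal.{v}) (_ : β < α), DevLE β (Set.Icc (f (n + 1)) (f n))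
termination_by α

/-- A module has (Gabriel–Rentschler) Krull dimension if the deviation of its lattice of
submodules is defined, i.e. bounded by some ordinal. -/
def HasKrullDimGR (R : Type u) [Ring R] (M : Type v) [AddCommGroup M] [Module R M] : Prop :=
  ∃ α : Ordinal.{max u v}, DevLE α (Submodule R M)

/-- The Gabriel–Rentschler Krull dimension of a module: the least ordinal bounding the
deviation of its lattice of submodules. -/
noncomputable def krullDimGR (R : Type u) [Ring R] (M : Type v) [AddCommGroup M]
    [Module R M] : Ordinal.{max u v} :=
  sInf {α : Ordinal.{max u v} | DevLE α (Submodule R M)}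

section Ore

variable {R : Type*} [Ring R]

/-- A multiplicative subset: contains `1`, omits `0` and is closed under multiplication. -/
def IsMultSet (S : Set R) : Prop :=
  1 ∈ S ∧ 0 ∉ S ∧ ∀ s ∈ S, ∀ t ∈ S, s * t ∈ S

/-- A left Ore set: a multiplicative set satisfying the left Ore condition. -/
def IsLeftOreSet (S : Set R) : Prop :=
  IsMultSet S ∧ ∀ (r : R), ∀ s ∈ S, ∃ s' ∈ S, ∃ r' : R, s' * r = r' * s

/-- `assL S = { r | s r = 0 for some s ∈ S }`. -/
def assL (S : Set R) : Set R := {r : R | ∃ s ∈ S, s * r = 0}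

/-- A left denominator set: a left Ore set such that `r s = 0` with `s ∈ S` implies
`t r = 0` for some `t ∈ S`. -/
def IsLeftDenominatorSet (S : Set R) : Prop :=
  IsLeftOreSet S ∧ ∀ (r : R), ∀ s ∈ S, r * s = 0 → ∃ t ∈ S, t * r = 0

/-- `θ : R →+* Q` realizes `Q` as the left localization `S⁻¹R` of `R` at `S`:
elements of `S` become units, the kernel of `θ` is `assL S`, and every element of `Q`
has the form `θ(s)⁻¹ θ(r)`. -/
structure IsLeftLocalization {Q : Type*} [Ring Q] (S : Set R) (θ : R →+* Q) : Prop where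
  isUnit : ∀ s ∈ S, IsUnit (θ s)
  ker_eq : ∀ r : R, θ r = 0 ↔ r ∈ assL S
  exists_rep : ∀ q : Q, ∃ s ∈ S, ∃ r : R, θ s * q = θ r

end Ore

section SemiprimeGoldie

variable {R : Type*} [Ring R]

/-- A semiprime ring has no nonzero element `a` with `a R a = 0`. -/
theorem IsSemiprimeRing'.eq_zero_of_mul_mul_eq_zero (h : IsSemiprimeRing' R) {a : R}
    (ha : ∀ r, a * r * a = 0) : a = 0 := by
  let A : TwoSidedIdeal R := .mk' {y | ∀ r, a * r * y = 0} (by simp)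
    (fun hx hy r => by rw [mul_add, hx r, hy r, add_zero])
    (fun hx r => by rw [mul_neg, hx r, neg_zero])
    (fun {x y} hy r => by rw [← mul_assoc, mul_assoc a r x]; exact hy (r * x))
    (fun {x y} hx r => by rw [← mul_assoc, hx r, zero_mul])
  have mem_A {y : R} : y ∈ A ↔ ∀ r, a * r * y = 0 := TwoSidedIdeal.mem_mk' ..
  have hA : TwoSidedIdeal.span {a} ≤ A :=
    TwoSidedIdeal.span_le.2 (Set.singleton_subset_iff.2 (mem_A.2 ha))
  let B : TwoSidedIdeal R := .mk' {x | ∀ y ∈ TwoSidedIdeal.span {a}, x * y = 0} (by simp)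
    (fun hx hx' y hy => by rw [add_mul, hx y hy, hx' y hy, add_zero])
    (fun hx y hy => by rw [neg_mul, hx y hy, neg_zero])
    (fun {r x} hx y hy => by rw [mul_assoc, hx y hy, mul_zero])
    (fun {x r} hx y hy => by
      rw [mul_assoc]; exact hx _ (TwoSidedIdeal.mul_mem_left _ r y hy))
  have mem_B {x : R} : x ∈ B ↔ ∀ y ∈ TwoSidedIdeal.span {a}, x * y = 0 :=
    TwoSidedIdeal.mem_mk' ..
  have hB : TwoSidedIdeal.span {a} ≤ B :=
    TwoSidedIdeal.span_le.2 (Set.singleton_subset_iff.2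
      (mem_B.2 fun y hy => by simpa using mem_A.1 (hA hy) 1))
  have hbot := h (TwoSidedIdeal.span {a}) ⟨2, two_pos, fun f hf => by
    simpa [List.ofFn_succ] using mem_B.1 (hB (hf 0)) _ (hf 1)⟩
  have hmem : a ∈ TwoSidedIdeal.span {a} := TwoSidedIdeal.subset_span rfl
  rwa [hbot, TwoSidedIdeal.mem_bot] at hmem

/-- A ring is semiprime if it has no nonzero element `a` with `a R a = 0`. -/
theorem IsSemiprimeRing'.of_eq_zero_of_mul_mul_eq_zero
    (h : ∀ a : R, (∀ r, a * r * a = 0) → a = 0) : IsSemiprimeRing' R := by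
  rintro N ⟨n, hn, hN⟩
  have hlist : ∀ l : List R, l.length = n → (∀ x ∈ l, x ∈ N) → l.prod = 0 := by
    rintro l rfl hl
    simpa using hN l.get fun i => hl _ (List.get_mem l i)
  clear hN
  induction n, hn using Nat.le_induction with
  | base =>
    refine (eq_bot_iff (a := N)).2 fun x hx => ?_
    simpa using hlist [x] rfl (by simpa using hx)
  | succ n hn ih =>
    refine ih fun l hl hlN => h _ fun r => ?_
    have hmem : l.prod ∈ N := by
      cases l with
      | nil => simp at hl; omega
      | cons x t =>
        rw [List.prod_cons]
        exact TwoSidedIdeal.mul_mem_right _ _ _ (hlN x (by simp))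
    have := hlist (l ++ [r * l.prod]) (by simp [hl]) (by
      intro x hx
      rcases List.mem_append.1 hx with hx | hx
      · exact hlN x hx
      · rw [List.mem_singleton.1 hx]
        exact TwoSidedIdeal.mul_mem_left _ _ _ hmem)
    simpa [mul_assoc] using this

theorem IsEssentialLeftIdeal.exists_mul_mem {I : Ideal R} (hI : IsEssentialLeftIdeal I)
    {x : R} (hx : x ≠ 0) : ∃ a, a * x ∈ I ∧ a * x ≠ 0 := by
  have hspan : Ideal.span {x} ≠ ⊥ := by simpa using hx
  obtain ⟨y, ⟨hyI, hyx⟩, hy⟩ := (Submodule.ne_bot_iff _).1 (hI _ hspan)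
  obtain ⟨a, rfl⟩ := Ideal.mem_span_singleton'.1 hyx
  exact ⟨a, hyI, hy⟩

/-- In a semiprime ring with a.c.c. on left annihilators the left singular ideal is zero: an
element whose left annihilator meets every nonzero left ideal vanishes. -/
theorem IsSemiprimeRing'.eq_zero_of_essential_annihilator (h : IsSemiprimeRing' R)
    (hacc : ACCLeftAnnihilators R) {z : R}
    (hz : ∀ x : R, x ≠ 0 → ∃ a, a * x ≠ 0 ∧ a * x * z = 0) : z = 0 := by
  by_contra hz0
  let Z : Set R := {z | ∀ x : R, x ≠ 0 → ∃ a, a * x ≠ 0 ∧ a * x * z = 0}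
  have step : ∀ z : {z : R // z ∈ Z ∧ z ≠ 0}, ∃ w : {z : R // z ∈ Z ∧ z ≠ 0},
      leftAnnihilator R {z.1} ⊂ leftAnnihilator R {w.1} := by
    rintro ⟨z, hzZ, hz0⟩
    obtain ⟨r, hr⟩ : ∃ r, z * r * z ≠ 0 := by
      by_contra! hr
      exact hz0 (h.eq_zero_of_mul_mul_eq_zero hr)
    refine ⟨⟨z * r * z, fun x hx => ?_, hr⟩, ?_⟩
    · obtain ⟨a, ha, haz⟩ := hzZ x hx
      exact ⟨a, ha, by rw [mul_assoc z, ← mul_assoc, haz, zero_mul]⟩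
    · obtain ⟨b, hb, hbz⟩ := hzZ (z * r) fun h0 => hr (by rw [h0, zero_mul])
      have hne : b * z ≠ 0 := fun h0 => hb (by rw [← mul_assoc, h0, zero_mul])
      refine ⟨fun c hc => ?_, fun hsub => hne ?_⟩
      · have hc : c * z = 0 := by simpa [leftAnnihilator] using hc
        simp only [leftAnnihilator, Set.mem_singleton_iff, forall_eq, Set.mem_ofPred_eq]
        rw [mul_assoc z, ← mul_assoc, hc, zero_mul]
      · simpa [leftAnnihilator] using
          hsub (show b ∈ leftAnnihilator R {z * r * z} by
            simpa [leftAnnihilator, mul_assoc] using hbz)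
  choose g hg using step
  let s : ℕ → {z : R // z ∈ Z ∧ z ≠ 0} := fun n => g^[n] ⟨z, hz, hz0⟩
  have hs : StrictMono fun n => leftAnnihilator R {(s n).1} :=
    strictMono_nat_of_lt_succ fun n => by
      simp only [s, Function.iterate_succ_apply']
      exact hg _
  obtain ⟨N, hN⟩ := hacc _ (fun n => ⟨_, rfl⟩) hs.monotone
  exact (hs N.lt_succ_self).ne' (hN _ N.le_succ)

/-- An essential left ideal of a semiprime ring with a.c.c. on left annihilators has zero right
annihilator. -/
theorem IsEssentialLeftIdeal.eq_zero_of_mul_eq_zero {I : Ideal R}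
    (hI : IsEssentialLeftIdeal I) (h : IsSemiprimeRing' R) (hacc : ACCLeftAnnihilators R)
    {a : R} (ha : ∀ x ∈ I, x * a = 0) : a = 0 :=
  h.eq_zero_of_essential_annihilator hacc fun _ hx =>
    let ⟨b, hb, hb0⟩ := hI.exists_mul_mem hx
    ⟨b, hb0, ha _ hb⟩

/-- The a.c.c. on left annihilators passes to subrings. -/
theorem ACCLeftAnnihilators.subring (h : ACCLeftAnnihilators R) (R' : Subring R) :
    ACCLeftAnnihilators R' := by
  intro f hf hmono
  let g : ℕ → Set R := fun n =>
    leftAnnihilator R {s | s ∈ R' ∧ ∀ c ∈ f n, (c : R) * s = 0}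
  have hg : Monotone g := fun m n hmn r hr s hs =>
    hr s ⟨hs.1, fun c hc => hs.2 c (hmono hmn hc)⟩
  have hfg : ∀ n, f n = {r : R' | (r : R) ∈ g n} := by
    intro n
    obtain ⟨S, hS⟩ := hf n
    refine Set.Subset.antisymm (fun r hr s hs => hs.2 r hr) fun r hr => ?_
    rw [hS]
    intro s hs
    refine Subtype.ext (hr s ⟨s.2, fun c hc => ?_⟩)
    rw [hS] at hc
    simpa using congrArg Subtype.val (hc s hs)
  obtain ⟨N, hN⟩ := h g (fun n => ⟨_, rfl⟩) hg
  exact ⟨N, fun n hn => by rw [hfg, hfg, hN n hn]⟩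

/-- Finite left uniform dimension passes to a subring which contains a left ideal with zero
right annihilator in the subring. -/
theorem HasFiniteLeftUniformDimension.subring (h : HasFiniteLeftUniformDimension R)
    {R' : Subring R} {I : Ideal R} (hIR' : (I : Set R) ⊆ R')
    (hI : ∀ a ∈ R', (∀ x ∈ I, x * a = 0) → a = 0) : HasFiniteLeftUniformDimension R' := by
  rintro ⟨J, hJ, hind⟩
  choose j hj hj0 using fun n => (Submodule.ne_bot_iff _).1 (hJ n)
  refine h ⟨fun n => Submodule.map (LinearMap.toSpanSingleton R R (j n : R)) I,
    fun n hn => hj0 n ?_, ?_⟩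
  · refine Subtype.ext (hI _ (j n).2 fun x hx => ?_)
    have hmem := Submodule.mem_map_of_mem
      (f := LinearMap.toSpanSingleton R R (j n : R)) hx
    simpa using hn.le hmem
  · rw [iSupIndep_iff_finsetSum_eq_zero_imp_eq_zero] at hind ⊢
    intro s v hv hsum
    have hlift : ∀ i ∈ s, ∃ w : R', w ∈ J i ∧ (w : R) = v i := by
      intro i hi
      obtain ⟨x, hx, hxv⟩ := Submodule.mem_map.1 (hv i hi)
      exact ⟨⟨x, hIR' hx⟩ * j i, (J i).mul_mem_left _ (hj i), by simpa using hxv⟩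
    choose! w hwJ hwv using hlift
    have hw := hind s w hwJ (Subtype.ext (by
      rw [AddSubmonoidClass.coe_finsetSum, Finset.sum_congr rfl hwv, hsum]; rfl))
    intro i hi
    rw [← hwv i hi, hw i hi]
    rfl

end SemiprimeGoldie

/-- **Theorem 2.4.(5).** If `R'` is a subring of a semiprime left Goldie ring `R`
containing an essential left ideal of `R`, then `R'` is a semiprime left Goldie ring. -/
theorem large_subring_is_semiprime_left_goldie {R : Type*} [Ring R]
    (hsemiprime : IsSemiprimeRing' R) (hgoldie : IsLeftGoldieRing R)
    (R' : Subring R)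
    (hlarge : ∃ I : Ideal R, IsEssentialLeftIdeal I ∧ (I : Set R) ⊆ (R' : Set R)) :
    IsSemiprimeRing' R' ∧ IsLeftGoldieRing R' := by
  obtain ⟨I, hI, hIR'⟩ := hlarge
  obtain ⟨hdim, hacc⟩ := hgoldie
  refine ⟨.of_eq_zero_of_mul_mul_eq_zero fun a ha => ?_,
    hdim.subring hIR' fun a _ => hI.eq_zero_of_mul_eq_zero hsemiprime hacc, hacc.subring R'⟩
  refine Subtype.ext (hI.eq_zero_of_mul_eq_zero hsemiprime hacc fun x hx =>
    hsemiprime.eq_zero_of_mul_mul_eq_zero fun r => ?_)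
  have harx : (a : R) * (r * x) * a = 0 :=
    congrArg Subtype.val (ha ⟨r * x, hIR' (I.mul_mem_left r hx)⟩)
  calc x * (a : R) * r * (x * a) = x * (a * (r * x) * a) := by simp only [mul_assoc]
    _ = 0 := by rw [harx, mul_zero]
end

section
/- Let R be a semiprime left Goldie ring and let R' be a subring of R containing an essential left ideal of R. Then the left uniform dimension of R' (as a left module over itself) equals the left uniform dimension of R. -/
theorem IsSemiprimeRing'.eq_zero_of_forall_mul_mul_eq_zero {R : Type*} [Ring R]
    (hR : IsSemiprimeRing' R) {a : R} (ha : ∀ r, a * r * a = 0) : a = 0 := by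
  have hleft : ∀ x ∈ TwoSidedIdeal.span {a}, ∀ r, a * r * x = 0 := by
    let J : TwoSidedIdeal R := TwoSidedIdeal.mk' {x | ∀ r, a * r * x = 0}
      (fun r => mul_zero _)
      (fun hx hy r => by rw [mul_add, hx r, hy r, add_zero])
      (fun hx r => by rw [mul_neg, hx r, neg_zero])
      (fun {x y} hy r => by simpa only [mul_assoc] using hy (r * x))
      (fun {x y} hx r => by rw [← mul_assoc, hx r, zero_mul])
    intro x hx
    have hxJ : x ∈ J := TwoSidedIdeal.mem_span_iff.1 hx J <| by
      rintro _ rfl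
      exact (TwoSidedIdeal.mem_mk' ..).2 ha
    exact (TwoSidedIdeal.mem_mk' ..).1 hxJ
  have hmul : ∀ y ∈ TwoSidedIdeal.span {a}, ∀ x ∈ TwoSidedIdeal.span {a}, y * x = 0 := by
    let J : TwoSidedIdeal R := TwoSidedIdeal.mk'
      {y | ∀ x ∈ TwoSidedIdeal.span {a}, y * x = 0}
      (fun x _ => zero_mul x)
      (fun hy hz x hx => by rw [add_mul, hy x hx, hz x hx, add_zero])
      (fun hy x hx => by rw [neg_mul, hy x hx, neg_zero])
      (fun hy x hx => by rw [mul_assoc, hy x hx, mul_zero])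
      (fun {y z} hy x hx => by
        rw [mul_assoc]
        exact hy _ (TwoSidedIdeal.mul_mem_left _ _ _ hx))
    intro y hy
    have hyJ : y ∈ J := TwoSidedIdeal.mem_span_iff.1 hy J <| by
      rintro _ rfl
      exact (TwoSidedIdeal.mem_mk' ..).2 fun x hx => by simpa using hleft x hx 1
    exact (TwoSidedIdeal.mem_mk' ..).1 hyJ
  have hbot := hR (TwoSidedIdeal.span {a})
    ⟨2, two_pos, fun f hf => by simpa using hmul _ (hf 0) _ (hf 1)⟩
  have hmem : a ∈ TwoSidedIdeal.span {a} := TwoSidedIdeal.subset_span rfl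
  rwa [hbot, TwoSidedIdeal.mem_bot] at hmem

theorem ACCLeftAnnihilators.wellFoundedGT {R : Type*} [Ring R] (hR : ACCLeftAnnihilators R) :
    WellFoundedGT {A : Set R // ∃ S : Set R, A = leftAnnihilator R S} := by
  rw [wellFoundedGT_iff_monotone_chain_condition]
  intro f
  obtain ⟨N, hN⟩ := hR (fun n => (f n).1) (fun n => (f n).2) fun _ _ h => f.monotone h
  exact ⟨N, fun n hn => Subtype.ext (hN n hn).symm⟩

/-- The left singular ideal of a semiprime ring with a.c.c. on left annihilators vanishes. -/
theorem IsEssentialLeftIdeal.eq_zero_of_forall_mul_eq_zero {R : Type*} [Ring R]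
    (hsemiprime : IsSemiprimeRing' R) (hacc : ACCLeftAnnihilators R) {I : Ideal R}
    (hI : IsEssentialLeftIdeal I) {x : R} (hx : ∀ y ∈ I, y * x = 0) : x = 0 := by
  by_contra hx0
  let ann (a : R) : {A : Set R // ∃ S : Set R, A = leftAnnihilator R S} :=
    ⟨leftAnnihilator R {a}, {a}, rfl⟩
  obtain ⟨-, ⟨a, ⟨ha0, ha⟩, rfl⟩, hmax⟩ := hacc.wellFoundedGT.wf.has_min
    (ann '' {a | a ≠ 0 ∧ ∀ y ∈ I, y * a = 0}) ⟨_, x, ⟨hx0, hx⟩, rfl⟩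
  refine ha0 (hsemiprime.eq_zero_of_forall_mul_mul_eq_zero fun r => ?_)
  by_contra hara
  have har : a * r ≠ 0 := fun h => hara (by rw [h, zero_mul])
  obtain ⟨z, hz, hz0⟩ := Submodule.exists_mem_ne_zero_of_ne_bot
    (hI (Ideal.span {a * r}) (by simpa using har))
  obtain ⟨hzI, hzspan⟩ := Submodule.mem_inf.1 hz
  obtain ⟨s, rfl⟩ := Ideal.mem_span_singleton'.1 hzspan
  refine hmax (ann (a * r * a)) ⟨_, ⟨hara, fun y hy => ?_⟩, rfl⟩ ?_
  · rw [← mul_assoc, ← mul_assoc, ha y hy, zero_mul, zero_mul]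
  · refine lt_of_le_not_ge ?_ fun hle => ?_
    · rintro t ht _ rfl
      rw [← mul_assoc, ← mul_assoc, ht a rfl, zero_mul, zero_mul]
    · have hs : s ∈ leftAnnihilator R {a} := hle <| by
        rintro _ rfl
        rw [← mul_assoc]
        exact ha _ hzI
      exact hz0 (by rw [← mul_assoc, hs a rfl, zero_mul])

theorem iSupIndep.of_forall_map_mem {ι R S M N : Type*} [Ring R] [Ring S] [AddCommGroup M]
    [AddCommGroup N] [Module R M] [Module S N] {p : ι → Submodule R M} {q : ι → Submodule S N}
    (φ : M →+ N) (hφ : Function.Injective φ) (hq : iSupIndep q)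
    (h : ∀ i, ∀ x ∈ p i, φ x ∈ q i) : iSupIndep p := by
  rw [iSupIndep_iff_finsetSum_eq_zero_imp_eq_zero] at hq ⊢
  intro s v hv hsum i hi
  refine (map_eq_zero_iff φ hφ).1 (hq s (fun i => φ (v i)) (fun j hj => h j _ (hv j hj)) ?_ i hi)
  rw [← map_sum, hsum, map_zero]

theorem iSupIndep.of_forall_exists_map_eq {ι R S M N : Type*} [Ring R] [Ring S] [AddCommGroup M]
    [AddCommGroup N] [Module R M] [Module S N] {p : ι → Submodule R M} {q : ι → Submodule S N}
    (φ : M →+ N) (hφ : Function.Injective φ) (hp : iSupIndep p)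
    (h : ∀ i, ∀ y ∈ q i, ∃ x ∈ p i, φ x = y) : iSupIndep q := by
  rw [iSupIndep_iff_finsetSum_eq_zero_imp_eq_zero] at hp ⊢
  intro s v hv hsum i hi
  choose! g hgp hg using h
  rw [← hg i _ (hv i hi), hp s (fun i => g i (v i)) (fun j hj => hgp j _ (hv j hj)) ?_ i hi,
    map_zero]
  apply hφ
  rw [map_sum, map_zero, ← hsum]
  exact Finset.sum_congr rfl fun j hj => hg j _ (hv j hj)

/-- **Theorem 2.4.(6).** If `R'` is a subring of a semiprime left Goldie ring `R`
containing an essential left ideal of `R`, then the left uniform dimension of `R'` (as a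
left module over itself) equals the left uniform dimension of `R`. -/
theorem udim_of_large_subring {R : Type*} [Ring R]
    (hsemiprime : IsSemiprimeRing' R) (hgoldie : IsLeftGoldieRing R)
    (R' : Subring R)
    (hlarge : ∃ I : Ideal R, IsEssentialLeftIdeal I ∧ (I : Set R) ⊆ (R' : Set R)) :
    udim R' R' = udim R R := by
  obtain ⟨I, hI, hIR'⟩ := hlarge
  apply le_antisymm
  · refine sSup_le_sSup ?_
    rintro _ ⟨k, f, rfl, hf0, hf⟩
    choose x hx hx0 using fun i => Submodule.exists_mem_ne_zero_of_ne_bot (hf0 i)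
    refine ⟨k, fun i => Submodule.map (LinearMap.toSpanSingleton R R (x i : R)) I, rfl,
      fun i hi => ?_,
      hf.of_forall_exists_map_eq R'.subtype.toAddMonoidHom Subtype.val_injective ?_⟩
    · refine hx0 i (Subtype.ext
        (hI.eq_zero_of_forall_mul_eq_zero hsemiprime hgoldie.2 fun y hy => ?_))
      exact (Submodule.eq_bot_iff _).1 hi _ (Submodule.mem_map_of_mem hy)
    · rintro i _ ⟨y, hy, rfl⟩
      exact ⟨⟨y, hIR' hy⟩ * x i, (f i).smul_mem _ (hx i), rfl⟩
  · refine sSup_le_sSup ?_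
    rintro _ ⟨k, f, rfl, hf0, hf⟩
    refine ⟨k, fun i => Ideal.comap R'.subtype (f i), rfl, fun i hi => ?_,
      hf.of_forall_map_mem R'.subtype.toAddMonoidHom Subtype.val_injective fun _ _ hx => hx⟩
    obtain ⟨z, hz, hz0⟩ := Submodule.exists_mem_ne_zero_of_ne_bot (hI (f i) (hf0 i))
    obtain ⟨hzI, hzf⟩ := Submodule.mem_inf.1 hz
    exact hz0 (congrArg Subtype.val
      ((Submodule.eq_bot_iff _).1 hi ⟨z, hIR' hzI⟩ (Ideal.mem_comap.2 hzf)))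
end
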